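/- Let n ≥ 1 and let w : Fin n → Fin n → EReal be edge lengths with no negative cycles, and let d₁ be the matrix after one run of the IKJ algorithm starting from d = w. Then for every shortest path [u₀, …, u_l] from s to t such that s = u₀ > u_b for all 0 < b < l (all interior vertices are smaller than s), one has d₁[s, t] = dist_w(s, t). -/

import Mathlib

open scoped BigOperators

noncomputable section

/-- The total `d`-length of a walk, given as the list of visited vertices.
A walk visiting at most one vertex has length `0`. -/
def walkLen {n : ℕ} (d : Fin n → Fin n → EReal) : List (Fin n) → EReal
  | [] => 0
  | [_] => 0
  | a :: b :: rest => d a b + walkLen d (b :: rest)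

/-- Shortest-path distance from `s` to `t`: the infimum of walk lengths over all
finite walks from `s` to `t` (the empty walk `[s]` from `s` to `s` has length `0`). -/
def distW {n : ℕ} (d : Fin n → Fin n → EReal) (s t : Fin n) : EReal :=
  sInf {c : EReal | ∃ u : List (Fin n),
    u.head? = some s ∧ u.getLast? = some t ∧ walkLen d u = c}

/-- No negative cycles: every closed walk has nonnegative total length. -/
def NoNegCycle {n : ℕ} (w : Fin n → Fin n → EReal) : Prop :=
  ∀ (u : List (Fin n)) (v : Fin n),
    u.head? = some v → u.getLast? = some v → 0 ≤ walkLen w u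

/-- The relaxation update `d[i,j] ← min (d[i,j]) (d[i,k] + d[k,j])`,
leaving all other entries unchanged. -/
def upd {n : ℕ} (d : Fin n → Fin n → EReal) (i j k : Fin n) :
    Fin n → Fin n → EReal :=
  fun x y => if x = i ∧ y = j then min (d i j) (d i k + d k j) else d x y

/-- All triples of `Fin n` in lexicographic order. -/
def triplesLex (n : ℕ) : List (Fin n × Fin n × Fin n) :=
  (List.finRange n).flatMap fun a =>
    (List.finRange n).flatMap fun b =>
      (List.finRange n).map fun c => (a, b, c)

/-- One run of the IJK algorithm: the triples `(i, j, k)` are processed in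
lexicographic order of `(i, j, k)`, updating `d[i,j] ← min (d[i,j]) (d[i,k] + d[k,j])`. -/
def runIJK {n : ℕ} (d : Fin n → Fin n → EReal) : Fin n → Fin n → EReal :=
  (triplesLex n).foldl (fun d t => upd d t.1 t.2.1 t.2.2) d

/-- One run of the IKJ algorithm: the triples `(i, k, j)` are processed in
lexicographic order of `(i, k, j)`, updating `d[i,j] ← min (d[i,j]) (d[i,k] + d[k,j])`. -/
def runIKJ {n : ℕ} (d : Fin n → Fin n → EReal) : Fin n → Fin n → EReal :=
  (triplesLex n).foldl (fun d t => upd d t.1 t.2.2 t.2.1) d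

/-- One run of the (correct) KIJ Floyd–Warshall algorithm: the triples `(k, i, j)` are
processed in lexicographic order of `(k, i, j)`,
updating `d[i,j] ← min (d[i,j]) (d[i,k] + d[k,j])`. -/
def runKIJ {n : ℕ} (d : Fin n → Fin n → EReal) : Fin n → Fin n → EReal :=
  (triplesLex n).foldl (fun d t => upd d t.2.1 t.2.2 t.1) d

/-- The partial run of the IJK algorithm consisting of all update triples `(i, j, k)`
with `i ≤ m`, in lexicographic order. -/
def runIJKUpto {n : ℕ} (m : Fin n) (d : Fin n → Fin n → EReal) :
    Fin n → Fin n → EReal :=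
  ((triplesLex n).filter (fun t => decide (t.1 ≤ m))).foldl
    (fun d t => upd d t.1 t.2.1 t.2.2) d

/-- The partial run of the IKJ algorithm consisting of all update triples `(i, k, j)`
with `i ≤ m`, in lexicographic order. -/
def runIKJUpto {n : ℕ} (m : Fin n) (d : Fin n → Fin n → EReal) :
    Fin n → Fin n → EReal :=
  ((triplesLex n).filter (fun t => decide (t.1 ≤ m))).foldl
    (fun d t => upd d t.1 t.2.2 t.2.1) d

/-- The `d`-length of the portion `u_a, u_{a+1}, …, u_c` of the vertex sequence `u`. -/
def pathLen {n : ℕ} (d : Fin n → Fin n → EReal) (u : ℕ → Fin n) (a c : ℕ) : EReal :=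
  ∑ p ∈ Finset.Ico a c, d (u p) (u (p + 1))

/-- `u_0, …, u_l` is a shortest path w.r.t. `w`: every sub-walk `u_a, …, u_c`
has `w`-length equal to the shortest-path distance from `u_a` to `u_c`. -/
def IsShortestPath {n : ℕ} (w : Fin n → Fin n → EReal) (u : ℕ → Fin n) (l : ℕ) : Prop :=
  ∀ a c, a ≤ c → c ≤ l → pathLen w u a c = distW w (u a) (u c)

/-- The `d`-length of the walk from `a` to `b` whose list of interior vertices is `L`. -/
def viaLen {n : ℕ} (d : Fin n → Fin n → EReal) : Fin n → List (Fin n) → Fin n → EReal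
  | a, [], b => d a b
  | a, x :: L, b => d a x + viaLen d x L b

theorem walkLen_cons_append_singleton {n : ℕ} (d : Fin n → Fin n → EReal) (a b : Fin n)
    (L : List (Fin n)) : walkLen d (a :: (L ++ [b])) = viaLen d a L b := by
  induction L generalizing a with
  | nil => simp [walkLen, viaLen]
  | cons x L ih => simp [walkLen, viaLen, ← ih]

theorem viaLen_append {n : ℕ} (d : Fin n → Fin n → EReal) (a x b : Fin n)
    (L M : List (Fin n)) :
    viaLen d a (L ++ x :: M) b = viaLen d a L x + viaLen d x M b := by
  induction L generalizing a with
  | nil => rfl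
  | cons y L ih => simp [viaLen, ih, add_assoc]

theorem distW_le_viaLen {n : ℕ} (d : Fin n → Fin n → EReal) (a b : Fin n)
    (L : List (Fin n)) : distW d a b ≤ viaLen d a L b :=
  sInf_le ⟨a :: (L ++ [b]), rfl, by rw [← List.cons_append, List.getLast?_concat],
    walkLen_cons_append_singleton d a b L⟩

theorem NoNegCycle.viaLen_nonneg {n : ℕ} {w : Fin n → Fin n → EReal} (h : NoNegCycle w)
    (a : Fin n) (L : List (Fin n)) : 0 ≤ viaLen w a L a := by
  rw [← walkLen_cons_append_singleton]
  exact h _ a rfl (by rw [← List.cons_append, List.getLast?_concat])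

/-- A walk through `x` can be split into a walk to the first visit of `x` and a walk from
the last visit of `x`, without increasing the total length. -/
theorem NoNegCycle.exists_split {n : ℕ} {w : Fin n → Fin n → EReal} (h : NoNegCycle w)
    (a b x : Fin n) (L : List (Fin n)) (hx : x ∈ L) :
    ∃ L₁ L₂ : List (Fin n), L₁ ⊆ L ∧ L₂ ⊆ L ∧ x ∉ L₁ ∧ x ∉ L₂ ∧
      viaLen w a L₁ x + viaLen w x L₂ b ≤ viaLen w a L b := by
  obtain ⟨L₁, R, rfl, h₁⟩ := List.eq_append_cons_of_mem hx
  by_cases hR : x ∈ R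
  · obtain ⟨A, B, hAB, hA⟩ := List.eq_append_cons_of_mem (List.mem_reverse.2 hR)
    obtain rfl : R = B.reverse ++ x :: A.reverse := by
      rw [← List.reverse_reverse R, hAB]; simp
    refine ⟨L₁, A.reverse, by simp, fun y hy => by simp_all, h₁, by simpa using hA, ?_⟩
    rw [viaLen_append, viaLen_append]
    exact add_le_add le_rfl (le_add_of_nonneg_left (h.viaLen_nonneg x _))
  · exact ⟨L₁, R, by simp, fun y hy => by simp [hy], h₁, hR, (viaLen_append ..).ge⟩

theorem exists_viaLen_eq_pathLen {n : ℕ} (d : Fin n → Fin n → EReal) (u : ℕ → Fin n)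
    (k : ℕ) : ∃ L : List (Fin n), (∀ x ∈ L, ∃ b, 0 < b ∧ b < k + 1 ∧ u b = x) ∧
      viaLen d (u 0) L (u (k + 1)) = pathLen d u 0 (k + 1) := by
  induction k with
  | zero => exact ⟨[], by simp, by simp [viaLen, pathLen]⟩
  | succ k ih =>
    obtain ⟨L, hL, h⟩ := ih
    refine ⟨L ++ [u (k + 1)], fun x hx => ?_, ?_⟩
    · rcases List.mem_append.1 hx with hx | hx
      · obtain ⟨b, h₁, h₂, h₃⟩ := hL x hx
        exact ⟨b, h₁, by omega, h₃⟩
      · exact ⟨k + 1, by omega, by omega, (List.mem_singleton.1 hx).symm⟩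
    · rw [viaLen_append, h]
      simp only [viaLen, pathLen]
      rw [Finset.sum_Ico_succ_top (by omega : 0 ≤ k + 1)]

/-- Induction principle for folds over all of `Fin n` in increasing order. -/
theorem foldl_finRange_induction {β : Type*} {n : ℕ} (f : β → Fin n → β) (P : ℕ → β → Prop)
    (b : β) (h₀ : P 0 b) (hs : ∀ (i : Fin n) (c : β), P i c → P (i + 1) (f c i)) :
    P n ((List.finRange n).foldl f b) := by
  induction n with
  | zero => simpa using h₀
  | succ n ih =>
    rw [List.finRange_succ_last, List.foldl_append, List.foldl_map]
    exact hs (Fin.last n) _ (ih (fun c i => f c i.castSucc) fun i c hc => hs i.castSucc c hc)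

theorem runIKJ_eq_foldl {n : ℕ} (d : Fin n → Fin n → EReal) :
    runIKJ d = (List.finRange n).foldl (fun d i => (List.finRange n).foldl (fun d k =>
      (List.finRange n).foldl (fun d j => upd d i j k) d) d) d := by
  simp [runIKJ, triplesLex, List.foldl_flatMap, List.foldl_map]

theorem upd_le {n : ℕ} (d : Fin n → Fin n → EReal) (i j k : Fin n) : upd d i j k ≤ d := by
  intro x y
  unfold upd
  split_ifs with h
  · rw [h.1, h.2]; exact min_le_left _ _
  · exact le_rfl

theorem upd_self_le {n : ℕ} (d : Fin n → Fin n → EReal) (i j k : Fin n) :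
    upd d i j k i j ≤ d i k + d k j := by
  simp [upd]

theorem foldl_upd_le {n : ℕ} (d : Fin n → Fin n → EReal) (i k : Fin n) :
    (List.finRange n).foldl (fun d j => upd d i j k) d ≤ d ∧
    ∀ j, (List.finRange n).foldl (fun d j => upd d i j k) d i j ≤ d i k + d k j := by
  have := foldl_finRange_induction (fun d j => upd d i j k)
    (fun m e => e ≤ d ∧ ∀ j : Fin n, (j : ℕ) < m → e i j ≤ d i k + d k j) d
    ⟨le_rfl, by simp⟩ ?_
  · exact ⟨this.1, fun j => this.2 j j.2⟩
  · rintro m e ⟨he, h⟩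
    refine ⟨le_trans (upd_le e i m k) he, fun j hj => ?_⟩
    rcases Nat.lt_succ_iff_lt_or_eq.1 hj with hj | hj
    · exact (upd_le e i m k i j).trans (h j hj)
    · obtain rfl := Fin.ext hj
      exact (upd_self_le ..).trans (add_le_add (he i k) (he k j))

/-- If the rows below `i` of `d` are bounded by the lengths of walks descending from their
first vertex, then so is row `i` once it has been processed. -/
theorem foldl_foldl_upd_le {n : ℕ} {w : Fin n → Fin n → EReal} (hw : NoNegCycle w)
    (d : Fin n → Fin n → EReal) (i : Fin n) (hd : d ≤ w)
    (hrow : ∀ k < i, ∀ (t : Fin n) (L : List (Fin n)), (∀ x ∈ L, x < k) →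
      d k t ≤ viaLen w k L t) :
    (List.finRange n).foldl
      (fun d k => (List.finRange n).foldl (fun d j => upd d i j k) d) d ≤ d ∧
    ∀ (t : Fin n) (L : List (Fin n)), (∀ x ∈ L, x < i) →
      (List.finRange n).foldl
        (fun d k => (List.finRange n).foldl (fun d j => upd d i j k) d) d i t
        ≤ viaLen w i L t := by
  have := foldl_finRange_induction
    (fun d k => (List.finRange n).foldl (fun d j => upd d i j k) d)
    (fun m e => e ≤ d ∧ ∀ (t : Fin n) (L : List (Fin n)),
      (∀ x ∈ L, (x : ℕ) < m ∧ x < i) → e i t ≤ viaLen w i L t) d ⟨le_rfl, ?_⟩ ?_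
  · exact ⟨this.1, fun t L hL => this.2 t L fun x hx => ⟨x.2, hL x hx⟩⟩
  · rintro t (_ | ⟨x, L⟩) hL
    · exact hd i t
    · exact absurd (hL x (by simp)).1 (Nat.not_lt_zero _)
  · rintro k e ⟨he, h⟩
    obtain ⟨hle, hstep⟩ := foldl_upd_le e i k
    refine ⟨hle.trans he, fun t L hL => ?_⟩
    have hlt : ∀ x ∈ L, x ≠ k → x < k := fun x hx hxk =>
      lt_of_le_of_ne (Nat.lt_succ_iff.1 (hL x hx).1) hxk
    by_cases hk : k ∈ L
    · obtain ⟨L₁, L₂, hs₁, hs₂, hk₁, hk₂, hlen⟩ := hw.exists_split i t k L hk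
      refine (hstep t).trans ((add_le_add (h k L₁ fun x hx => ?_) ?_).trans hlen)
      · exact ⟨hlt x (hs₁ hx) (ne_of_mem_of_not_mem hx hk₁), (hL x (hs₁ hx)).2⟩
      · exact (he k t).trans (hrow k (hL k hk).2 t L₂ fun x hx =>
          hlt x (hs₂ hx) (ne_of_mem_of_not_mem hx hk₂))
    · exact (hle i t).trans (h t L fun x hx =>
        ⟨hlt x hx (ne_of_mem_of_not_mem hx hk), (hL x hx).2⟩)

theorem NoNegCycle.runIKJ_le_viaLen {n : ℕ} {w : Fin n → Fin n → EReal} (hw : NoNegCycle w)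
    (s t : Fin n) (L : List (Fin n)) (hL : ∀ x ∈ L, x < s) :
    runIKJ w s t ≤ viaLen w s L t := by
  rw [runIKJ_eq_foldl]
  refine (foldl_finRange_induction _ (fun m e => e ≤ w ∧ ∀ i : Fin n, (i : ℕ) < m →
    ∀ (t : Fin n) (L : List (Fin n)), (∀ x ∈ L, x < i) → e i t ≤ viaLen w i L t) w
    ⟨le_rfl, by simp⟩ ?_).2 s s.2 t L hL
  rintro m e ⟨he, h⟩
  obtain ⟨hle, hrow⟩ := foldl_foldl_upd_le hw e m he fun k hk => h k hk
  refine ⟨hle.trans he, fun i hi t L hL => ?_⟩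
  rcases Nat.lt_succ_iff_lt_or_eq.1 hi with hi | hi
  · exact (hle i t).trans (h i hi t L hL)
  · obtain rfl := Fin.ext hi
    exact hrow t L hL

theorem exists_viaLen_eq_runIKJ {n : ℕ} (w : Fin n → Fin n → EReal) (i j : Fin n) :
    ∃ L, viaLen w i L j = runIKJ w i j := by
  have key : ∀ (T : List (Fin n × Fin n × Fin n)) (d : Fin n → Fin n → EReal),
      (∀ i j, ∃ L, viaLen w i L j = d i j) →
      ∀ i j, ∃ L, viaLen w i L j = T.foldl (fun d t => upd d t.1 t.2.2 t.2.1) d i j := by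
    intro T
    induction T with
    | nil => exact fun d hd => hd
    | cons p T ih =>
      refine fun d hd => ih _ fun x y => ?_
      dsimp only [upd]
      split_ifs with h
      · obtain ⟨rfl, rfl⟩ := h
        rcases min_choice (d p.1 p.2.2) (d p.1 p.2.1 + d p.2.1 p.2.2) with h | h <;> rw [h]
        · exact hd _ _
        · obtain ⟨L, hL⟩ := hd p.1 p.2.1
          obtain ⟨M, hM⟩ := hd p.2.1 p.2.2
          exact ⟨L ++ p.2.1 :: M, by rw [viaLen_append, hL, hM]⟩
      · exact hd x y
  exact key _ w (fun i j => ⟨[], rfl⟩) i j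

/-- If some shortest path `u_0, …, u_l` from `s` to `t` has all its
interior vertices below `s`, then one run of the IKJ algorithm already computes the
exact entry at `(s, t)`. -/
theorem ikj_one_run_exact_of_descent (n : ℕ) (hn : 1 ≤ n)
    (w : Fin n → Fin n → EReal) (hw : ∀ i j, w i j ≠ ⊥) (hncyc : NoNegCycle w)
    (s t : Fin n) (u : ℕ → Fin n) (l : ℕ) (hl : 0 < l)
    (hus : u 0 = s) (hut : u l = t) (hsp : IsShortestPath w u l)
    (hmid : ∀ b, 0 < b → b < l → u b < u 0) :
    runIKJ w s t = distW w s t := by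
  apply le_antisymm
  · obtain ⟨k, rfl⟩ := Nat.exists_eq_succ_of_ne_zero hl.ne'
    obtain ⟨L, hL, h⟩ := exists_viaLen_eq_pathLen w u k
    rw [← hus, ← hut, ← hsp 0 (k + 1) (Nat.zero_le _) le_rfl, ← h]
    refine hncyc.runIKJ_le_viaLen _ _ L fun x hx => ?_
    obtain ⟨b, hb, hbk, rfl⟩ := hL x hx
    exact hmid b hb hbk
  · obtain ⟨L, hL⟩ := exists_viaLen_eq_runIKJ w s t
    exact hL ▸ distW_le_viaLen w s t L
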